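/- For every n ≥ 1, the left ascent-plateau polynomial N_n(x), a polynomial of degree n, is alternatingly increasing; consequently N_n(x) is unimodal with mode ⌈n/2⌉. -/

import Mathlib

open Polynomial Finset

/-- A candidate Stirling permutation of order `n`: a word of length `2n` with
letters in `[n]` (encoded as `Fin n`). -/
abbrev StWord (n : ℕ) := Fin (2 * n) → Fin n

/-- The letter of a word at position `i ∈ [2n]` (1-indexed, values in `[n]`),
with the convention that the value is `0` outside `[1, 2n]` (so `σ_0 = 0`). -/
def qval (n : ℕ) (σ : StWord n) (i : ℕ) : ℕ :=
  if h : 1 ≤ i ∧ i ≤ 2 * n then (σ ⟨i - 1, by omega⟩ : Fin n).val + 1 else 0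

/-- `σ` is a Stirling permutation: each letter of `[n]` occurs exactly twice,
and all entries between the two occurrences of any letter are larger than it. -/
def IsStirling (n : ℕ) (σ : StWord n) : Prop :=
  (∀ k : Fin n, (Finset.univ.filter (fun i => σ i = k)).card = 2) ∧
  (∀ a b c : Fin (2 * n), a < b → b < c → σ a = σ c → σ a < σ b)

instance (n : ℕ) : DecidablePred (IsStirling n) := fun σ => by
  unfold IsStirling; infer_instance

/-- The ascent-plateau number `ap(σ) = #{i ∈ [2, 2n-1] : σ_{i-1} < σ_i = σ_{i+1}}`. -/
def ap (n : ℕ) (σ : StWord n) : ℕ :=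
  ((Finset.Icc 2 (2 * n - 1)).filter
    (fun i => qval n σ (i - 1) < qval n σ i ∧ qval n σ i = qval n σ (i + 1))).card

/-- The left ascent-plateau number
`lap(σ) = #{i ∈ [2n-1] : σ_{i-1} < σ_i = σ_{i+1}}` with `σ_0 = 0`. -/
def lap (n : ℕ) (σ : StWord n) : ℕ :=
  ((Finset.Icc 1 (2 * n - 1)).filter
    (fun i => qval n σ (i - 1) < qval n σ i ∧ qval n σ i = qval n σ (i + 1))).card

/-- `L_n^E(x) = Σ_{σ ∈ Q_n, σ_1 < σ_2} x^{ap(σ)}`. -/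
noncomputable def LEpoly (n : ℕ) : Polynomial ℝ :=
  ∑ σ ∈ Finset.univ.filter
      (fun σ : StWord n => IsStirling n σ ∧ qval n σ 1 < qval n σ 2),
    X ^ ap n σ

/-- `L_n^O(x) = Σ_{σ ∈ Q_n, σ_1 = σ_2} x^{ap(σ)}`. -/
noncomputable def LOpoly (n : ℕ) : Polynomial ℝ :=
  ∑ σ ∈ Finset.univ.filter
      (fun σ : StWord n => IsStirling n σ ∧ qval n σ 1 = qval n σ 2),
    X ^ ap n σ

/-- The left ascent-plateau polynomial `N_n(x) = Σ_{σ ∈ Q_n} x^{lap(σ)}`. -/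
noncomputable def Npoly (n : ℕ) : Polynomial ℝ :=
  ∑ σ ∈ Finset.univ.filter (fun σ : StWord n => IsStirling n σ), X ^ lap n σ

/-- The position in the word of order `n + 1` of the `j`-th letter of a word of order `n`, after
two letters have been inserted into its gap `g`. -/
def shiftPos {n : ℕ} (g : Fin (2 * n + 1)) (j : Fin (2 * n)) : Fin (2 * (n + 1)) :=
  ⟨if j.val < g.val then j.val else j.val + 2, by split_ifs <;> omega⟩

/-- Insert two copies of the new largest letter into the gap `g` of `σ`. -/
def insertMax {n : ℕ} (σ : StWord n) (g : Fin (2 * n + 1)) : StWord (n + 1) := fun i =>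
  if h : i.val < g.val then (σ ⟨i.val, by omega⟩).castSucc
  else if h' : i.val < g.val + 2 then Fin.last n
  else (σ ⟨i.val - 2, by omega⟩).castSucc

lemma shiftPos_strictMono {n : ℕ} (g : Fin (2 * n + 1)) : StrictMono (shiftPos g) := by
  intro a b hab
  have : a.val < b.val := hab
  simp only [shiftPos, Fin.mk_lt_mk]
  split_ifs <;> omega

lemma insertMax_shiftPos {n : ℕ} (σ : StWord n) (g : Fin (2 * n + 1)) (j : Fin (2 * n)) :
    insertMax σ g (shiftPos g j) = (σ j).castSucc := by
  by_cases h : j.val < g.val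
  · simp [insertMax, shiftPos, h]
  · have h1 : ¬ j.val + 2 < g.val := by omega
    simp [insertMax, shiftPos, h, h1]

lemma insertMax_eq_last {n : ℕ} (σ : StWord n) (g : Fin (2 * n + 1)) (i : Fin (2 * (n + 1))) :
    insertMax σ g i = Fin.last n ↔ i.val = g.val ∨ i.val = g.val + 1 := by
  unfold insertMax
  split_ifs with h h'
  · simp only [Fin.castSucc_ne_last, false_iff]; omega
  · simp only [true_iff]; omega
  · simp only [Fin.castSucc_ne_last, false_iff]; omega

lemma exists_shiftPos {n : ℕ} (g : Fin (2 * n + 1)) (i : Fin (2 * (n + 1))) :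
    (i.val = g.val ∨ i.val = g.val + 1) ∨ ∃ j, i = shiftPos g j := by
  by_cases h : i.val < g.val
  · exact Or.inr ⟨⟨i.val, by omega⟩, by simp [shiftPos, h]⟩
  by_cases h' : i.val < g.val + 2
  · left; omega
  · refine Or.inr ⟨⟨i.val - 2, by omega⟩, Fin.ext ?_⟩
    simp only [shiftPos]
    split_ifs <;> omega

lemma insertMax_injective {n : ℕ} {σ σ' : StWord n} {g g' : Fin (2 * n + 1)}
    (h : insertMax σ g = insertMax σ' g') : σ = σ' ∧ g = g' := by
  have key (i : Fin (2 * (n + 1))) :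
      (i.val = g.val ∨ i.val = g.val + 1) ↔ (i.val = g'.val ∨ i.val = g'.val + 1) := by
    rw [← insertMax_eq_last σ, ← insertMax_eq_last σ', h]
  have h1 := (key ⟨g.val, by omega⟩).1 (Or.inl rfl)
  have h2 := (key ⟨g'.val, by omega⟩).2 (Or.inl rfl)
  have hg : g = g' := by
    apply Fin.ext
    simp only at h1 h2
    omega
  subst hg
  refine ⟨funext fun j => ?_, rfl⟩
  have := congrFun h (shiftPos g j)
  simpa [insertMax_shiftPos] using this

lemma card_filter_insertMax_castSucc {n : ℕ} (σ : StWord n) (g : Fin (2 * n + 1)) (k : Fin n) :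
    (univ.filter fun i => insertMax σ g i = k.castSucc).card =
      (univ.filter fun j => σ j = k).card := by
  rw [← card_image_of_injective _ (shiftPos_strictMono g).injective]
  congr 1
  ext i
  simp only [mem_filter, mem_univ, true_and, mem_image]
  constructor
  · intro hi
    rcases exists_shiftPos g i with h | ⟨j, rfl⟩
    · rw [(insertMax_eq_last σ g i).2 h] at hi
      exact absurd hi.symm (Fin.castSucc_ne_last k)
    · exact ⟨j, by simpa [insertMax_shiftPos] using hi, rfl⟩
  · rintro ⟨j, rfl, rfl⟩
    exact insertMax_shiftPos σ g j

lemma card_filter_insertMax_last {n : ℕ} (σ : StWord n) (g : Fin (2 * n + 1)) :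
    (univ.filter fun i => insertMax σ g i = Fin.last n).card = 2 := by
  rw [card_eq_two]
  refine ⟨⟨g.val, by omega⟩, ⟨g.val + 1, by omega⟩, by simp, ?_⟩
  ext i
  rw [mem_filter, insertMax_eq_last]
  simp [Fin.ext_iff]

lemma isStirling_insertMax {n : ℕ} (σ : StWord n) (g : Fin (2 * n + 1)) :
    IsStirling (n + 1) (insertMax σ g) ↔ IsStirling n σ := by
  constructor
  · rintro ⟨hcard, hlt⟩
    refine ⟨fun k => ?_, fun a b c hab hbc hac => ?_⟩
    · rw [← card_filter_insertMax_castSucc σ g]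
      exact hcard _
    · have := hlt (shiftPos g a) (shiftPos g b) (shiftPos g c) (shiftPos_strictMono g hab)
        (shiftPos_strictMono g hbc) (by simp [insertMax_shiftPos, hac])
      simpa [insertMax_shiftPos] using this
  · rintro ⟨hcard, hlt⟩
    refine ⟨fun k => ?_, fun a b c hab hbc hac => ?_⟩
    · induction k using Fin.lastCases with
      | last => exact card_filter_insertMax_last σ g
      | cast k => rw [card_filter_insertMax_castSucc]; exact hcard k
    · have hab' : a.val < b.val := hab
      have hbc' : b.val < c.val := hbc
      rcases exists_shiftPos g a with ha | ⟨a, rfl⟩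
      · have hc := hac.symm.trans ((insertMax_eq_last σ g a).2 ha)
        rw [insertMax_eq_last] at hc
        omega
      rcases exists_shiftPos g c with hc | ⟨c, rfl⟩
      · have ha := hac.trans ((insertMax_eq_last σ g c).2 hc)
        simp [insertMax_shiftPos] at ha
      rcases exists_shiftPos g b with hb | ⟨b, rfl⟩
      · rw [(insertMax_eq_last σ g b).2 hb, insertMax_shiftPos]
        exact Fin.castSucc_lt_last _
      · simp only [insertMax_shiftPos, Fin.castSucc_inj, Fin.castSucc_lt_castSucc_iff] at hac ⊢
        exact hlt a b c ((shiftPos_strictMono g).lt_iff_lt.1 hab)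
          ((shiftPos_strictMono g).lt_iff_lt.1 hbc) hac

lemma exists_insertMax_eq {n : ℕ} (τ : StWord (n + 1)) (hτ : IsStirling (n + 1) τ) :
    ∃ σ g, insertMax σ g = τ := by
  obtain ⟨p, q, hpq, hfil⟩ : ∃ p q : Fin (2 * (n + 1)), p < q ∧
      univ.filter (fun i => τ i = Fin.last n) = {p, q} := by
    obtain ⟨p, q, hne, h⟩ := card_eq_two.1 (hτ.1 (Fin.last n))
    rcases lt_or_gt_of_ne hne with hlt | hlt
    · exact ⟨p, q, hlt, h⟩
    · exact ⟨q, p, hlt, by rw [h, pair_comm]⟩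
  have hlast (i) : τ i = Fin.last n ↔ i = p ∨ i = q := by
    simpa using Finset.ext_iff.1 hfil i
  have hpq' : p.val < q.val := hpq
  have hq : q.val = p.val + 1 := by
    by_contra hne
    have h := hτ.2 p ⟨p.val + 1, by omega⟩ q (Fin.lt_def.2 (by simp))
      (Fin.lt_def.2 (by simp only; omega)) (by rw [(hlast p).2 (Or.inl rfl), (hlast q).2 (Or.inr rfl)])
    rw [(hlast p).2 (Or.inl rfl)] at h
    exact absurd h (not_lt.2 (Fin.le_last _))
  let g : Fin (2 * n + 1) := ⟨p.val, by omega⟩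
  have hex (j : Fin (2 * n)) : ∃ a : Fin n, a.castSucc = τ (shiftPos g j) := by
    refine Fin.exists_castSucc_eq.2 fun h => ?_
    rw [hlast, Fin.ext_iff, Fin.ext_iff] at h
    simp only [shiftPos, g] at h
    split_ifs at h <;> omega
  choose σ hσ using hex
  refine ⟨σ, g, funext fun i => ?_⟩
  rcases exists_shiftPos g i with h | ⟨j, rfl⟩
  · rw [(insertMax_eq_last σ g i).2 h, eq_comm, hlast, Fin.ext_iff, Fin.ext_iff]
    simp only [g] at h
    omega
  · rw [insertMax_shiftPos, hσ]

lemma qval_le {n : ℕ} (σ : StWord n) (i : ℕ) : qval n σ i ≤ n := by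
  unfold qval
  split_ifs <;> omega

lemma qval_insertMax {n : ℕ} (σ : StWord n) (g : Fin (2 * n + 1)) (i : ℕ) :
    qval (n + 1) (insertMax σ g) i =
      if i ≤ g.val then qval n σ i else if i ≤ g.val + 2 then n + 1 else qval n σ (i - 2) := by
  have hg := g.isLt
  unfold qval insertMax
  by_cases h0 : 1 ≤ i ∧ i ≤ 2 * (n + 1)
  · rw [dif_pos h0]
    by_cases h1 : i ≤ g.val
    · rw [dif_pos (by simp only; omega), if_pos h1, dif_pos (by omega)]
      simp
    · rw [dif_neg (by simp only; omega), if_neg h1]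
      by_cases h2 : i ≤ g.val + 2
      · rw [dif_pos (by simp only; omega), if_pos h2]
        simp
      · rw [dif_neg (by simp only; omega), if_neg h2, dif_pos (by omega)]
        simp only [Fin.val_castSucc]
        congr 4
  · rw [dif_neg h0]
    split_ifs <;> omega

/-- The positions of the left ascent-plateaux of `σ`. -/
def plateaux {n : ℕ} (σ : StWord n) : Finset ℕ :=
  (Finset.Icc 1 (2 * n - 1)).filter
    (fun i => qval n σ (i - 1) < qval n σ i ∧ qval n σ i = qval n σ (i + 1))

lemma lap_eq_card_plateaux {n : ℕ} (σ : StWord n) : lap n σ = (plateaux σ).card := rfl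

lemma mem_plateaux {n : ℕ} {σ : StWord n} {i : ℕ} :
    i ∈ plateaux σ ↔ (1 ≤ i ∧ i ≤ 2 * n - 1) ∧
      qval n σ (i - 1) < qval n σ i ∧ qval n σ i = qval n σ (i + 1) := by
  simp [plateaux]

lemma succ_notMem_plateaux {n : ℕ} {σ : StWord n} {i : ℕ} (hi : i ∈ plateaux σ) :
    i + 1 ∉ plateaux σ := by
  intro h
  rw [mem_plateaux] at hi h
  simp only [Nat.add_sub_cancel] at h
  omega

lemma mem_plateaux_insertMax {n : ℕ} (σ : StWord n) (g : Fin (2 * n + 1)) (i : ℕ) :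
    i ∈ plateaux (insertMax σ g) ↔
      (i < g.val ∧ i ∈ plateaux σ) ∨ i = g.val + 1 ∨ (g.val + 4 ≤ i ∧ i - 2 ∈ plateaux σ) := by
  have hg := g.isLt
  simp only [mem_plateaux, qval_insertMax]
  have a1 := qval_le σ (i - 1)
  have a2 := qval_le σ i
  have a3 := qval_le σ (i - 2)
  have a4 := qval_le σ (i + 1 - 2)
  rcases lt_or_ge i g.val with h | h
  · rw [if_pos (by omega), if_pos (by omega), if_pos (by omega)]
    omega
  rcases Nat.lt_or_ge i (g.val + 4) with h' | h'
  · split_ifs <;> omega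
  · rw [if_neg (by omega), if_neg (by omega), if_neg (by omega), if_neg (by omega),
      if_neg (by omega), if_neg (by omega), show i - 1 - 2 = i - 2 - 1 by omega,
      show i + 1 - 2 = i - 2 + 1 by omega]
    omega

lemma lap_insertMax {n : ℕ} (σ : StWord n) (g : Fin (2 * n + 1)) :
    lap (n + 1) (insertMax σ g) =
      if g.val ∈ plateaux σ ∨ g.val + 1 ∈ plateaux σ then lap n σ else lap n σ + 1 := by
  have hcard : lap (n + 1) (insertMax σ g) =
      (((plateaux σ).erase g.val).erase (g.val + 1)).card + 1 := by
    have hinj : Function.Injective fun i : ℕ => if i < g.val then i else i + 2 := by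
      intro a b hab
      simp only at hab
      split_ifs at hab <;> omega
    rw [lap_eq_card_plateaux,
      ← card_image_of_injective (((plateaux σ).erase g.val).erase (g.val + 1)) hinj,
      ← card_insert_of_notMem (a := g.val + 1)]
    · congr 1
      ext i
      rw [mem_plateaux_insertMax]
      simp only [mem_insert, mem_image, mem_erase]
      constructor
      · rintro (⟨h, hi⟩ | h | ⟨h, hi⟩)
        · exact Or.inr ⟨i, ⟨by omega, by omega, hi⟩, by simp [h]⟩
        · exact Or.inl h
        · exact Or.inr ⟨i - 2, ⟨by omega, by omega, hi⟩, by split_ifs <;> omega⟩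
      · rintro (h | ⟨j, ⟨h1, h2, hj⟩, rfl⟩)
        · exact Or.inr (Or.inl h)
        · split_ifs with h
          · exact Or.inl ⟨h, hj⟩
          · exact Or.inr (Or.inr ⟨by omega, by simpa using hj⟩)
    · simp only [mem_image, mem_erase, not_exists, not_and]
      intro j hj
      split_ifs <;> omega
  rw [hcard, lap_eq_card_plateaux]
  by_cases h1 : g.val ∈ plateaux σ
  · have h2 := succ_notMem_plateaux h1
    rw [if_pos (Or.inl h1), erase_eq_of_notMem (fun h => h2 (mem_of_mem_erase h)),
      card_erase_add_one h1]
  · rw [erase_eq_of_notMem h1]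
    by_cases h2 : g.val + 1 ∈ plateaux σ
    · rw [if_pos (Or.inr h2), card_erase_add_one h2]
    · rw [if_neg (by tauto), erase_eq_of_notMem h2]

lemma card_gaps_touching_plateaux {n : ℕ} (σ : StWord n) :
    (univ.filter fun g : Fin (2 * n + 1) => g.val ∈ plateaux σ ∨ g.val + 1 ∈ plateaux σ).card =
      2 * lap n σ := by
  have hpred : Set.InjOn Nat.pred (plateaux σ) := by
    intro a ha b hb hab
    rw [mem_coe, mem_plateaux] at ha hb
    simp only [Nat.pred_eq_sub_one] at hab
    omega
  have hdisj : Disjoint (plateaux σ) ((plateaux σ).image Nat.pred) := by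
    rw [disjoint_left]
    intro i hi hi'
    obtain ⟨j, hj, rfl⟩ := mem_image.1 hi'
    apply succ_notMem_plateaux hi
    have := (mem_plateaux.1 hj).1.1
    rwa [← Nat.succ_eq_add_one, Nat.succ_pred_eq_of_pos this]
  rw [← card_image_of_injective _ Fin.val_injective, lap_eq_card_plateaux, two_mul #(plateaux σ)]
  nth_rewrite 2 [← card_image_of_injOn hpred]
  rw [← card_union_of_disjoint hdisj]
  congr 1
  ext i
  simp only [mem_image, mem_filter, mem_univ, true_and, mem_union]
  constructor
  · rintro ⟨g, h | h, rfl⟩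
    · exact Or.inl h
    · exact Or.inr ⟨_, h, rfl⟩
  · rintro (h | ⟨j, hj, rfl⟩)
    · have := (mem_plateaux.1 h).1
      exact ⟨⟨i, by omega⟩, Or.inl h, rfl⟩
    · have h := (mem_plateaux.1 hj).1
      refine ⟨⟨j.pred, by rw [Nat.pred_eq_sub_one]; omega⟩, Or.inr ?_, rfl⟩
      rwa [← Nat.succ_eq_add_one, Nat.succ_pred_eq_of_pos h.1]

lemma sum_lap_insertMax {n : ℕ} (σ : StWord n) :
    ∑ g, (X : ℝ[X]) ^ lap (n + 1) (insertMax σ g) =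
      C (2 * (lap n σ : ℝ)) * X ^ lap n σ +
        C (2 * (n : ℝ) + 1 - 2 * lap n σ) * X ^ (lap n σ + 1) := by
  have hsplit := card_filter_add_card_filter_not (s := (univ : Finset (Fin (2 * n + 1))))
    (fun g => g.val ∈ plateaux σ ∨ g.val + 1 ∈ plateaux σ)
  rw [card_gaps_touching_plateaux, card_univ, Fintype.card_fin] at hsplit
  have hcast : ((univ.filter fun g : Fin (2 * n + 1) =>
      ¬ (g.val ∈ plateaux σ ∨ g.val + 1 ∈ plateaux σ)).card : ℝ) =
      2 * (n : ℝ) + 1 - 2 * lap n σ := by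
    rw [eq_sub_iff_add_eq']
    exact_mod_cast hsplit
  simp_rw [lap_insertMax, pow_ite]
  rw [sum_ite, sum_const, sum_const, card_gaps_touching_plateaux, ← hcast, nsmul_eq_mul,
    nsmul_eq_mul]
  simp only [Nat.cast_mul, Nat.cast_ofNat, C_mul, map_natCast, map_ofNat]

lemma Npoly_succ_eq_sum (n : ℕ) :
    Npoly (n + 1) = ∑ σ ∈ univ.filter (fun σ : StWord n => IsStirling n σ),
      ∑ g, (X : ℝ[X]) ^ lap (n + 1) (insertMax σ g) := by
  rw [Npoly, ← sum_product']
  symm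
  refine sum_bij (fun p _ => insertMax p.1 p.2) ?_ ?_ ?_ ?_
  · intro p hp
    simpa [isStirling_insertMax] using hp
  · intro p _ q _ h
    exact Prod.ext_iff.2 (insertMax_injective h)
  · intro τ hτ
    simp only [mem_filter, mem_univ, true_and] at hτ
    obtain ⟨σ, g, rfl⟩ := exists_insertMax_eq τ hτ
    exact ⟨(σ, g), by simpa [isStirling_insertMax] using hτ, rfl⟩
  · intros
    rfl

lemma Npoly_zero : Npoly 0 = 1 := by
  have : IsEmpty (Fin (2 * 0)) := Fin.isEmpty
  have h : (univ.filter fun σ : StWord 0 => IsStirling 0 σ) = univ := by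
    exact filter_true_of_mem fun σ _ => ⟨fun k => k.elim0, fun a => isEmptyElim a⟩
  rw [Npoly, h, Fintype.sum_unique]
  simp [lap]

lemma coeff_Npoly_succ_zero (n : ℕ) : (Npoly (n + 1)).coeff 0 = 0 := by
  rw [Npoly_succ_eq_sum, finsetSum_coeff]
  refine sum_eq_zero fun σ _ => ?_
  rw [sum_lap_insertMax]
  simp only [coeff_add, coeff_C_mul, coeff_X_pow]
  split_ifs with h <;> simp_all

lemma coeff_Npoly_succ_succ (n k : ℕ) :
    (Npoly (n + 1)).coeff (k + 1) =
      2 * ((k : ℝ) + 1) * (Npoly n).coeff (k + 1) +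
        (2 * (n : ℝ) + 1 - 2 * k) * (Npoly n).coeff k := by
  rw [Npoly_succ_eq_sum, Npoly, finsetSum_coeff, finsetSum_coeff, finsetSum_coeff, mul_sum,
    mul_sum, ← sum_add_distrib]
  refine sum_congr rfl fun σ _ => ?_
  rw [sum_lap_insertMax]
  simp only [coeff_add, coeff_C_mul, coeff_X_pow, add_left_inj]
  congr 1
  · split_ifs with h
    · rw [← h]; push_cast; ring
    · simp
  · split_ifs with h
    · rw [← h]
    · simp

lemma coeff_Npoly_nonneg (n k : ℕ) : 0 ≤ (Npoly n).coeff k := by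
  rw [Npoly, finsetSum_coeff]
  refine sum_nonneg fun σ _ => ?_
  rw [coeff_X_pow]
  split_ifs <;> norm_num

lemma coeff_Npoly_of_lt {n k : ℕ} (h : n < k) : (Npoly n).coeff k = 0 := by
  induction n generalizing k with
  | zero => rw [Npoly_zero, coeff_one, if_neg (by omega)]
  | succ n ih =>
    obtain ⟨k, rfl⟩ : ∃ j, k = j + 1 := ⟨k - 1, by omega⟩
    rw [coeff_Npoly_succ_succ, ih (by omega), ih (by omega)]
    simp

lemma coeff_Npoly_self (n : ℕ) : (Npoly n).coeff n = 1 := by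
  induction n with
  | zero => simp [Npoly_zero]
  | succ n ih =>
    rw [coeff_Npoly_succ_succ, ih, coeff_Npoly_of_lt (Nat.lt_succ_self n)]
    ring

lemma natDegree_Npoly (n : ℕ) : (Npoly n).natDegree = n :=
  natDegree_eq_of_le_of_coeff_ne_zero
    (natDegree_le_iff_coeff_eq_zero.2 fun _ h => coeff_Npoly_of_lt h)
    (by simp [coeff_Npoly_self])

lemma coeff_Npoly_alternating (n : ℕ) :
    (∀ i, 2 * i ≤ n → (Npoly n).coeff i ≤ (Npoly n).coeff (n - i)) ∧
    (∀ i, 2 * i + 1 ≤ n → (Npoly n).coeff (n - i) ≤ (Npoly n).coeff (i + 1)) := by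
  induction n with
  | zero =>
    refine ⟨fun i hi => ?_, fun i hi => by omega⟩
    obtain rfl : i = 0 := by omega
    rfl
  | succ n ih =>
    obtain ⟨ih₁, ih₂⟩ := ih
    constructor
    · rintro (_ | i) hi
      · rw [coeff_Npoly_succ_zero]
        exact coeff_Npoly_nonneg _ _
      rcases eq_or_lt_of_le hi with hi | hi
      · rw [show n + 1 - (i + 1) = i + 1 by omega]
      obtain ⟨m, rfl⟩ : ∃ m, n = m + i + 1 := ⟨n - i - 1, by omega⟩
      have h₁ := ih₁ i (by omega)
      have h₂ := ih₂ i (by omega)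
      have h₃ := ih₁ (i + 1) (by omega)
      rw [show m + i + 1 - i = m + 1 by omega] at h₁ h₂
      rw [show m + i + 1 - (i + 1) = m by omega] at h₃
      rw [show m + i + 1 + 1 - (i + 1) = m + 1 by omega, coeff_Npoly_succ_succ _ i,
        coeff_Npoly_succ_succ _ m]
      push_cast
      have hm : (0 : ℝ) ≤ m := m.cast_nonneg
      have hi0 : (0 : ℝ) ≤ i := i.cast_nonneg
      nlinarith [mul_nonneg hm (sub_nonneg.2 h₁), mul_nonneg hi0 (sub_nonneg.2 h₃)]
    · intro i hi
      rcases eq_or_lt_of_le hi with hi | hi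
      · rw [show n + 1 - i = i + 1 by omega]
      obtain ⟨m, rfl⟩ : ∃ m, n = m + i := ⟨n - i, by omega⟩
      have h₁ : (Npoly (m + i)).coeff (m + 1) ≤ (Npoly (m + i)).coeff i := by
        rcases i with _ | i
        · rw [coeff_Npoly_of_lt (by omega)]
          exact coeff_Npoly_nonneg _ _
        · have := ih₂ i (by omega)
          rwa [show m + (i + 1) - i = m + 1 by omega] at this
      have h₂ := ih₁ i (by omega)
      have h₃ := ih₂ i (by omega)
      rw [show m + i - i = m by omega] at h₂ h₃
      rw [show m + i + 1 - i = m + 1 by omega, coeff_Npoly_succ_succ _ m, coeff_Npoly_succ_succ _ i]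
      push_cast
      have hm : (0 : ℝ) ≤ m := m.cast_nonneg
      have hi0 : (0 : ℝ) ≤ i := i.cast_nonneg
      nlinarith [mul_nonneg hm (sub_nonneg.2 h₁), mul_nonneg hi0 (sub_nonneg.2 h₃)]

/-- For every `n ≥ 1`, `N_n(x)` has degree `n` and is alternatingly
increasing, i.e. its coefficients satisfy
`f_0 ≤ f_n ≤ f_1 ≤ f_{n-1} ≤ ⋯ ≤ f_{⌊(n+1)/2⌋}`; consequently `N_n(x)` is
unimodal with mode `⌈n/2⌉`. -/
theorem Npoly_alternatingly_increasing (n : ℕ) (hn : 1 ≤ n) :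
    (Npoly n).natDegree = n ∧
    -- alternatingly increasing
    (∀ i, 2 * i ≤ n → (Npoly n).coeff i ≤ (Npoly n).coeff (n - i)) ∧
    (∀ i, 2 * i + 1 ≤ n → (Npoly n).coeff (n - i) ≤ (Npoly n).coeff (i + 1)) ∧
    -- unimodal with mode ⌈n/2⌉
    (∀ i, i < (n + 1) / 2 → (Npoly n).coeff i ≤ (Npoly n).coeff (i + 1)) ∧
    (∀ i, (n + 1) / 2 ≤ i → i < n →
      (Npoly n).coeff (i + 1) ≤ (Npoly n).coeff i) := by
  obtain ⟨h₁, h₂⟩ := coeff_Npoly_alternating n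
  refine ⟨natDegree_Npoly n, h₁, h₂, fun i hi => ?_, fun i hi hin => ?_⟩
  · exact (h₁ i (by omega)).trans (h₂ i (by omega))
  · have h₃ := h₂ (n - i - 1) (by omega)
    have h₄ := h₁ (n - i) (by omega)
    rw [show n - (n - i - 1) = i + 1 by omega, show n - i - 1 + 1 = n - i by omega] at h₃
    rw [show n - (n - i) = i by omega] at h₄
    exact h₃.trans h₄
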